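/- arXiv:2008.09055 — 5 statements merged into one kernel-verified Lean document; each statement's English description precedes it below -/
import Mathlib

section
/- Let E be a real inner product space, ψ : E → ℝ a convex function, η > 0, and fix x, d, v ∈ E. Let x̄ ∈ E be a minimizer over E of y ↦ ψ(y) + (1/(2η))‖y − (x − ηd)‖², let x⁺ ∈ E be a minimizer over E of y ↦ ψ(y) + (1/(2η))‖y − (x − ηv)‖², and set G := (1/η)(x − x̄). Then ψ(x⁺) + (1/(2η))‖x⁺ − x‖² ≤ ψ(x) − (η/2)‖G‖² − (1/(2η))‖x̄ − x⁺‖² + ⟨v, x̄ − x⁺⟩ − ⟨d, x̄ − x⟩. -/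
open scoped RealInnerProductSpace

/-- A minimizer of the sum of a convex function and `c‖· - u‖²` satisfies the quadratic growth
inequality with modulus `c`. -/
theorem ConvexOn.quadratic_growth_of_minimizer
    {E : Type*} [NormedAddCommGroup E] [InnerProductSpace ℝ E]
    {ψ : E → ℝ} (hψ : ConvexOn ℝ Set.univ ψ) {c : ℝ} {u p : E}
    (hp : ∀ y : E, ψ p + c * ‖p - u‖ ^ 2 ≤ ψ y + c * ‖y - u‖ ^ 2) (y : E) :
    ψ p + c * ‖p - u‖ ^ 2 + c * ‖y - p‖ ^ 2 ≤ ψ y + c * ‖y - u‖ ^ 2 := by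
  have key : ∀ t ∈ Set.Ioo (0 : ℝ) 1,
      ψ p + c * ‖p - u‖ ^ 2 + c * (1 - t) * ‖y - p‖ ^ 2 ≤ ψ y + c * ‖y - u‖ ^ 2 := by
    rintro t ⟨ht0, ht1⟩
    have hconv := hψ.2 (Set.mem_univ p) (Set.mem_univ y) (sub_nonneg.2 ht1.le) ht0.le
      (sub_add_cancel 1 t)
    have hmin := hp ((1 - t) • p + t • y)
    have hvec : (1 - t) • p + t • y - u = (1 - t) • (p - u) + t • (y - u) := by module
    have hdiff : y - p = (y - u) - (p - u) := by abel
    have hsq : ‖(1 - t) • p + t • y - u‖ ^ 2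
        = (1 - t) * ‖p - u‖ ^ 2 + t * ‖y - u‖ ^ 2 - t * (1 - t) * ‖y - p‖ ^ 2 := by
      rw [hvec, hdiff, norm_add_sq_real, norm_sub_sq_real (y - u), norm_smul, norm_smul, mul_pow,
        mul_pow,
        Real.norm_eq_abs, Real.norm_eq_abs, sq_abs, sq_abs, real_inner_smul_left,
        real_inner_smul_right, real_inner_comm (p - u) (y - u)]
      ring
    rw [hsq] at hmin
    simp only [smul_eq_mul] at hconv
    refine le_of_mul_le_mul_left ?_ ht0
    linarith
  have hlim : Filter.Tendsto
      (fun t : ℝ => ψ p + c * ‖p - u‖ ^ 2 + c * (1 - t) * ‖y - p‖ ^ 2)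
      (nhdsWithin 0 (Set.Ioi 0)) (nhds (ψ p + c * ‖p - u‖ ^ 2 + c * ‖y - p‖ ^ 2)) := by
    refine (Continuous.tendsto' (by fun_prop) _ _ ?_).mono_left nhdsWithin_le_nhds
    simp
  refine le_of_tendsto hlim ?_
  filter_upwards [Ioo_mem_nhdsGT (zero_lt_one' ℝ)] with t ht using key t ht

/-- Key intermediate inequality in the descent lemma (Lemma 3), combining the optimality
conditions of the two proximal subproblems `x̄ = prox_{ηψ}(x - ηd)` and
`x⁺ = prox_{ηψ}(x - ηv)`, with gradient mapping `G = (1/η)(x - x̄)`. -/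
theorem prox_combined_inequality
    {E : Type*} [NormedAddCommGroup E] [InnerProductSpace ℝ E]
    (ψ : E → ℝ) (hψ : ConvexOn ℝ Set.univ ψ)
    (η : ℝ) (hη : 0 < η) (x d v xbar xplus : E)
    (hbar : ∀ y : E, ψ xbar + (1 / (2 * η)) * ‖xbar - (x - η • d)‖ ^ 2
      ≤ ψ y + (1 / (2 * η)) * ‖y - (x - η • d)‖ ^ 2)
    (hplus : ∀ y : E, ψ xplus + (1 / (2 * η)) * ‖xplus - (x - η • v)‖ ^ 2
      ≤ ψ y + (1 / (2 * η)) * ‖y - (x - η • v)‖ ^ 2)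
    (G : E) (hG : G = (1 / η) • (x - xbar)) :
    ψ xplus + (1 / (2 * η)) * ‖xplus - x‖ ^ 2
      ≤ ψ x - (η / 2) * ‖G‖ ^ 2 - (1 / (2 * η)) * ‖xbar - xplus‖ ^ 2
        + ⟪v, xbar - xplus⟫ - ⟪d, xbar - x⟫ := by
  have hexpand : ∀ y w : E, (1 / (2 * η)) * ‖y - (x - η • w)‖ ^ 2
      = (1 / (2 * η)) * ‖y - x‖ ^ 2 + ⟪w, y - x⟫ + (η / 2) * ‖w‖ ^ 2 := by
    intro y w
    rw [show y - (x - η • w) = (y - x) + η • w by abel, norm_add_sq_real, norm_smul,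
      real_inner_smul_right, real_inner_comm, mul_pow, Real.norm_eq_abs, sq_abs]
    field_simp
  have h₁ := hψ.quadratic_growth_of_minimizer hbar x
  have h₂ := hψ.quadratic_growth_of_minimizer hplus xbar
  simp only [hexpand, sub_self, norm_zero, inner_zero_right] at h₁ h₂
  have hGsq : (η / 2) * ‖G‖ ^ 2 = (1 / (2 * η)) * ‖x - xbar‖ ^ 2 := by
    rw [hG, norm_smul, mul_pow, Real.norm_eq_abs, sq_abs]
    field_simp
  have hinner : ⟪v, xbar - xplus⟫ = ⟪v, xbar - x⟫ - ⟪v, xplus - x⟫ := by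
    rw [← inner_sub_right, sub_sub_sub_cancel_right]
  rw [hGsq, hinner]
  linarith
end

section
/- Let E be a real inner product space, let f : E → ℝ be differentiable with L-Lipschitz gradient (L > 0), let ψ : E → ℝ be convex, and let η > 0. Fix x, v ∈ E, let x̄ be a minimizer over E of y ↦ ψ(y) + (1/(2η))‖y − (x − η∇f(x))‖², let x⁺ be a minimizer over E of y ↦ ψ(y) + (1/(2η))‖y − (x − ηv)‖², and set G_η(x) := (1/η)(x − x̄) and F := f + ψ. Then F(x⁺) ≤ F(x) − (1/(2η) − L/2)‖x⁺ − x‖² − (η/2)‖G_η(x)‖² + (η/2)‖∇f(x) − v‖². -/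
/-- The quadratic upper bound for a differentiable function with `L`-Lipschitz gradient. -/
theorem le_add_inner_add_of_lipschitz_gradient
    {E : Type*} [NormedAddCommGroup E] [InnerProductSpace ℝ E] [CompleteSpace E]
    {f : E → ℝ} {gradf : E → E} (hf : ∀ x : E, HasGradientAt f (gradf x) x)
    {L : ℝ} (hlip : ∀ x y : E, ‖gradf x - gradf y‖ ≤ L * ‖x - y‖) (x y : E) :
    f y ≤ f x + inner ℝ (gradf x) (y - x) + L / 2 * ‖y - x‖ ^ 2 := by
  have hline (t : ℝ) : HasDerivAt (fun s : ℝ => x + s • (y - x)) (y - x) t := by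
    simpa using ((hasDerivAt_id t).smul_const (y - x)).const_add x
  have hderiv (t : ℝ) : HasDerivAt
      (fun s : ℝ => f (x + s • (y - x)) -
        (s * inner ℝ (gradf x) (y - x) + L / 2 * ‖y - x‖ ^ 2 * s ^ 2))
      (inner ℝ (gradf (x + t • (y - x))) (y - x) -
        (inner ℝ (gradf x) (y - x) + L * ‖y - x‖ ^ 2 * t)) t := by
    have h₁ : HasDerivAt (fun s : ℝ => f (x + s • (y - x)))
        (inner ℝ (gradf (x + t • (y - x))) (y - x)) t := by
      have h := (hf (x + t • (y - x))).hasFDerivAt.comp_hasDerivAt t (hline t)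
      rwa [InnerProductSpace.toDual_apply_apply] at h
    have h₂ := ((hasDerivAt_id t).mul_const (inner ℝ (gradf x) (y - x))).add
      ((hasDerivAt_pow 2 t).const_mul (L / 2 * ‖y - x‖ ^ 2))
    refine (h₁.sub h₂).congr_deriv ?_
    norm_num
    ring
  have hanti := antitoneOn_of_deriv_nonpos (convex_Icc (0 : ℝ) 1)
    (fun t _ => (hderiv t).continuousAt.continuousWithinAt)
    (fun t _ => (hderiv t).differentiableAt.differentiableWithinAt) (by
      intro t ht
      rw [interior_Icc] at ht
      rw [(hderiv t).deriv]
      have hcs := real_inner_le_norm (gradf (x + t • (y - x)) - gradf x) (y - x)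
      have hgrad := hlip (x + t • (y - x)) x
      rw [add_sub_cancel_left, norm_smul, Real.norm_of_nonneg ht.1.le] at hgrad
      rw [inner_sub_left] at hcs
      nlinarith [mul_le_mul_of_nonneg_right hgrad (norm_nonneg (y - x))])
  have h := hanti (Set.left_mem_Icc.2 zero_le_one) (Set.right_mem_Icc.2 zero_le_one) zero_le_one
  norm_num at h
  linarith

/-- The three-point inequality for a minimizer `p` of `ψ + c ‖· - u‖ ^ 2`. -/
theorem ConvexOn.three_point_of_isMin_add_sq
    {E : Type*} [NormedAddCommGroup E] [InnerProductSpace ℝ E]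
    {ψ : E → ℝ} (hψ : ConvexOn ℝ Set.univ ψ) {c : ℝ} {p u : E}
    (hp : ∀ y : E, ψ p + c * ‖p - u‖ ^ 2 ≤ ψ y + c * ‖y - u‖ ^ 2) (y : E) :
    ψ p + c * ‖p - u‖ ^ 2 + c * ‖y - p‖ ^ 2 ≤ ψ y + c * ‖y - u‖ ^ 2 := by
  have hseg : ∀ t ∈ Set.Ioo (0 : ℝ) 1,
      ψ p + c * ‖p - u‖ ^ 2 + c * (1 - t) * ‖y - p‖ ^ 2 ≤ ψ y + c * ‖y - u‖ ^ 2 := by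
    rintro t ⟨ht₀, ht₁⟩
    have hmin := hp ((1 - t) • p + t • y)
    have hconv := hψ.2 (Set.mem_univ p) (Set.mem_univ y) (sub_nonneg.2 ht₁.le) ht₀.le
      (sub_add_cancel 1 t)
    have hsq : ‖(1 - t) • p + t • y - u‖ ^ 2 =
        (1 - t) * ‖p - u‖ ^ 2 + t * ‖y - u‖ ^ 2 - t * (1 - t) * ‖y - p‖ ^ 2 := by
      have h₁ : (1 - t) • p + t • y - u = (p - u) + t • (y - p) := by module
      have h₂ : y - u = (p - u) + (y - p) := by abel
      rw [h₁, h₂, norm_add_sq_real, norm_add_sq_real, inner_smul_right, norm_smul, mul_pow,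
        Real.norm_eq_abs, sq_abs]
      ring
    rw [hsq] at hmin
    simp only [smul_eq_mul] at hconv
    refine le_of_mul_le_mul_left ?_ ht₀
    linarith
  have hlim : Filter.Tendsto (fun t : ℝ => ψ p + c * ‖p - u‖ ^ 2 + c * (1 - t) * ‖y - p‖ ^ 2)
      (nhdsWithin 0 (Set.Ioi 0)) (nhds (ψ p + c * ‖p - u‖ ^ 2 + c * (1 - 0) * ‖y - p‖ ^ 2)) :=
    (Continuous.tendsto (by fun_prop) 0).mono_left nhdsWithin_le_nhds
  rw [sub_zero, mul_one] at hlim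
  refine le_of_tendsto hlim ?_
  filter_upwards [Ioo_mem_nhdsGT (zero_lt_one : (0 : ℝ) < 1)] with t ht using hseg t ht

/-- The three-point inequality for the proximal step `p` from `x` along `w`. -/
theorem ConvexOn.three_point_of_prox_step
    {E : Type*} [NormedAddCommGroup E] [InnerProductSpace ℝ E]
    {ψ : E → ℝ} (hψ : ConvexOn ℝ Set.univ ψ) {η : ℝ} (hη : η ≠ 0) {x w p : E}
    (hp : ∀ y : E, ψ p + (1 / (2 * η)) * ‖p - (x - η • w)‖ ^ 2
      ≤ ψ y + (1 / (2 * η)) * ‖y - (x - η • w)‖ ^ 2) (y : E) :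
    ψ p + inner ℝ w (p - x) + (1 / (2 * η)) * (‖p - x‖ ^ 2 + ‖y - p‖ ^ 2)
      ≤ ψ y + inner ℝ w (y - x) + (1 / (2 * η)) * ‖y - x‖ ^ 2 := by
  have hsq (z : E) : (1 / (2 * η)) * ‖z - (x - η • w)‖ ^ 2 =
      (1 / (2 * η)) * ‖z - x‖ ^ 2 + inner ℝ w (z - x) + η / 2 * ‖w‖ ^ 2 := by
    have h : z - (x - η • w) = (z - x) + η • w := by abel
    rw [h, norm_add_sq_real, inner_smul_right, norm_smul, mul_pow, Real.norm_eq_abs, sq_abs,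
      real_inner_comm]
    field_simp
  have h := hψ.three_point_of_isMin_add_sq hp y
  rw [hsq, hsq] at h
  linarith

/-- Young's inequality for the real inner product. -/
theorem real_inner_le_weighted_sq {E : Type*} [NormedAddCommGroup E] [InnerProductSpace ℝ E]
    {η : ℝ} (hη : 0 < η) (a b : E) :
    inner ℝ a b ≤ η / 2 * ‖a‖ ^ 2 + (1 / (2 * η)) * ‖b‖ ^ 2 := by
  refine (real_inner_le_norm a b).trans ?_
  have h : η / 2 * ‖a‖ ^ 2 + (1 / (2 * η)) * ‖b‖ ^ 2 - ‖a‖ * ‖b‖ =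
      (1 / (2 * η)) * (η * ‖a‖ - ‖b‖) ^ 2 := by
    field_simp
    ring
  exact sub_nonneg.1 (h ▸ by positivity)

/-- Deterministic core of the one-iteration descent lemma (Lemma 3): the inexact
proximal-gradient step `x⁺ = prox_{ηψ}(x - ηv)` with approximate gradient `v` decreases
`F = f + ψ` up to the gradient-approximation error `‖∇f(x) - v‖²`. -/
theorem descent_lemma_prox_grad
    {E : Type*} [NormedAddCommGroup E] [InnerProductSpace ℝ E] [CompleteSpace E]
    (f : E → ℝ) (gradf : E → E) (hf : ∀ x : E, HasGradientAt f (gradf x) x)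
    (L : ℝ) (hL : 0 < L) (hlip : ∀ x y : E, ‖gradf x - gradf y‖ ≤ L * ‖x - y‖)
    (ψ : E → ℝ) (hψ : ConvexOn ℝ Set.univ ψ)
    (η : ℝ) (hη : 0 < η) (x v xbar xplus : E)
    (hbar : ∀ y : E, ψ xbar + (1 / (2 * η)) * ‖xbar - (x - η • gradf x)‖ ^ 2
      ≤ ψ y + (1 / (2 * η)) * ‖y - (x - η • gradf x)‖ ^ 2)
    (hplus : ∀ y : E, ψ xplus + (1 / (2 * η)) * ‖xplus - (x - η • v)‖ ^ 2
      ≤ ψ y + (1 / (2 * η)) * ‖y - (x - η • v)‖ ^ 2)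
    (G : E) (hG : G = (1 / η) • (x - xbar)) :
    f xplus + ψ xplus
      ≤ f x + ψ x - (1 / (2 * η) - L / 2) * ‖xplus - x‖ ^ 2
        - (η / 2) * ‖G‖ ^ 2 + (η / 2) * ‖gradf x - v‖ ^ 2 := by
  have hdesc := le_add_inner_add_of_lipschitz_gradient hf hlip x xplus
  have hbar' := hψ.three_point_of_prox_step hη.ne' hbar x
  have hplus' := hψ.three_point_of_prox_step hη.ne' hplus xbar
  have hyoung := real_inner_le_weighted_sq hη (gradf x - v) (xplus - xbar)
  have hG' : η / 2 * ‖G‖ ^ 2 = (1 / (2 * η)) * ‖xbar - x‖ ^ 2 := by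
    rw [hG, norm_smul, mul_pow, Real.norm_eq_abs, sq_abs, norm_sub_rev x xbar]
    field_simp
  have hinner : inner ℝ (gradf x - v) (xplus - xbar) =
      inner ℝ (gradf x) (xplus - x) - inner ℝ (gradf x) (xbar - x)
        - inner ℝ v (xplus - x) + inner ℝ v (xbar - x) := by
    simp only [inner_sub_left, inner_sub_right]
    ring
  rw [hinner, norm_sub_rev xplus xbar] at hyoung
  rw [sub_self, inner_zero_right, norm_zero, norm_sub_rev x xbar] at hbar'
  rw [hG']
  linarith
end

section
/- Let E be a real inner product space, f : E → ℝ differentiable, ψ : E → ℝ convex, and η > 0. For x ∈ E let prox_{ηψ}(x − η∇f(x)) denote the minimizer over E of y ↦ ψ(y) + (1/(2η))‖y − (x − η∇f(x))‖², and define the gradient mapping G_η(x) := (1/η)(x − prox_{ηψ}(x − η∇f(x))). Then for any x⋆ ∈ E, G_η(x⋆) = 0 if and only if −∇f(x⋆) is a subgradient of ψ at x⋆, i.e. ψ(y) ≥ ψ(x⋆) + ⟨−∇f(x⋆), y − x⋆⟩ for all y ∈ E. -/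
open scoped RealInnerProductSpace

/-- Completing the square in the proximal objective at a gradient step `x - η • g`. -/
lemma prox_objective_expand {E : Type*} [NormedAddCommGroup E] [InnerProductSpace ℝ E]
    {η : ℝ} (hη : η ≠ 0) (x g y : E) :
    (1 / (2 * η)) * ‖y - (x - η • g)‖ ^ 2
      = (1 / (2 * η)) * ‖y - x‖ ^ 2 + ⟪g, y - x⟫ + η / 2 * ‖g‖ ^ 2 := by
  have h : y - (x - η • g) = (y - x) + η • g := by abel
  rw [h, norm_add_sq_real, inner_smul_right, norm_smul, mul_pow, Real.norm_eq_abs, sq_abs,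
    real_inner_comm g (y - x)]
  field_simp

/-- An affine function of `t` that is nonnegative on `(0, 1]` is nonnegative at `0`. -/
lemma nonneg_of_forall_add_mul_nonneg {a d : ℝ} (hd : 0 ≤ d)
    (h : ∀ t : ℝ, 0 < t → t ≤ 1 → 0 ≤ a + t * d) : 0 ≤ a := by
  by_contra! ha
  have hda : 0 < d - a := by linarith
  have ht := h (-a / (d - a)) (div_pos (by linarith) hda)
    ((div_le_one hda).2 (by linarith))
  have heq : a + -a / (d - a) * d = -(a ^ 2 / (d - a)) := by
    field_simp
    ring
  have : 0 < a ^ 2 / (d - a) := div_pos (by nlinarith) hda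
  linarith

/-- A convex function that is bounded below by `ψ x` up to a linear and a quadratic term
around `x` has the negated linear term as a subgradient at `x`. -/
lemma ConvexOn.subgradient_of_quadratic_bound {E : Type*} [NormedAddCommGroup E]
    [InnerProductSpace ℝ E] {ψ : E → ℝ} (hψ : ConvexOn ℝ Set.univ ψ) {c : ℝ} (hc : 0 ≤ c)
    {x g : E} (h : ∀ z : E, ψ x ≤ ψ z + ⟪g, z - x⟫ + c * ‖z - x‖ ^ 2) (y : E) :
    ψ x - ⟪g, y - x⟫ ≤ ψ y := by
  suffices 0 ≤ ψ y - ψ x + ⟪g, y - x⟫ by linarith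
  refine nonneg_of_forall_add_mul_nonneg (d := c * ‖y - x‖ ^ 2) (by positivity) ?_
  intro t ht ht1
  have hconv := hψ.2 (Set.mem_univ x) (Set.mem_univ y) (sub_nonneg.2 ht1) ht.le (by ring)
  have hz := h ((1 - t) • x + t • y)
  have hzx : (1 - t) • x + t • y - x = t • (y - x) := by module
  rw [hzx, inner_smul_right, norm_smul, mul_pow, Real.norm_eq_abs, sq_abs] at hz
  simp only [smul_eq_mul] at hconv
  have hmul : 0 ≤ t * (ψ y - ψ x + ⟪g, y - x⟫ + t * (c * ‖y - x‖ ^ 2)) := by linarith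
  exact nonneg_of_mul_nonneg_right hmul ht

/-- The gradient mapping `G_η(x⋆) = (1/η)(x⋆ - prox_{ηψ}(x⋆ - η∇f(x⋆)))` vanishes if and
only if `-∇f(x⋆)` is a subgradient of the convex function `ψ` at `x⋆`. -/
theorem gradient_mapping_zero_iff_stationary
    {E : Type*} [NormedAddCommGroup E] [InnerProductSpace ℝ E] [CompleteSpace E]
    (f : E → ℝ) (gradf : E → E) (hf : ∀ x : E, HasGradientAt f (gradf x) x)
    (ψ : E → ℝ) (hψ : ConvexOn ℝ Set.univ ψ)
    (η : ℝ) (hη : 0 < η) (xstar p : E)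
    (hp : ∀ y : E, ψ p + (1 / (2 * η)) * ‖p - (xstar - η • gradf xstar)‖ ^ 2
      ≤ ψ y + (1 / (2 * η)) * ‖y - (xstar - η • gradf xstar)‖ ^ 2) :
    (1 / η) • (xstar - p) = 0 ↔
      ∀ y : E, ψ y ≥ ψ xstar + ⟪-gradf xstar, y - xstar⟫ := by
  have hc : 0 < 1 / (2 * η) := by positivity
  have hmin : ∀ y : E, ψ p + ⟪gradf xstar, p - xstar⟫ + (1 / (2 * η)) * ‖p - xstar‖ ^ 2
      ≤ ψ y + ⟪gradf xstar, y - xstar⟫ + (1 / (2 * η)) * ‖y - xstar‖ ^ 2 := by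
    intro y
    have h := hp y
    rw [prox_objective_expand hη.ne', prox_objective_expand hη.ne'] at h
    linarith
  rw [smul_eq_zero_iff_right (by positivity), sub_eq_zero]
  simp only [inner_neg_left]
  constructor
  · rintro rfl y
    have h := hψ.subgradient_of_quadratic_bound hc.le (fun z => by simpa using hmin z) y
    linarith
  · intro h
    have hx := hmin xstar
    simp only [sub_self, inner_zero_right, norm_zero] at hx
    have hle : (1 / (2 * η)) * ‖p - xstar‖ ^ 2 ≤ 0 := by linarith [h p]
    have hsq : ‖p - xstar‖ ^ 2 = 0 :=
      le_antisymm (nonpos_of_mul_nonpos_right hle hc) (sq_nonneg _)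
    exact (sub_eq_zero.1 (norm_eq_zero.1 (pow_eq_zero_iff two_ne_zero |>.1 hsq))).symm
end

section
/- Let L > 0, σ ≥ 0, η ∈ (0, 1/(2L)), and β satisfy 2L²η²/(1 − Lη) ≤ β < 1. Let T ≥ 0 be a natural number and let (E_t)_{t=0}^{T+1}, (G_t)_{t=0}^{T}, (D_t)_{t=0}^{T}, (S_t)_{t=0}^{T} be nonnegative real numbers satisfying, for every 0 ≤ t ≤ T: E_{t+1} ≤ E_t − (1/(2η) − L/2) D_t − (η/2) G_t + (η/2) S_t, and S_t ≤ (1−β)^{2t} S_0 + 2βσ² + 2L² ∑_{i=0}^{t−1} (1−β)^{2(t−i)} D_i. Then (1/(T+1)) ∑_{t=0}^{T} G_t ≤ 2 E_0 / (η(T+1)) + S_0 / (β(T+1)) + 2βσ². -/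
/-- If `β ≤ 1 - r`, a geometric sum with ratio `r` is at most `1 / β`. -/
theorem mul_sum_pow_add_pow_le_one {r β : ℝ} (hr : 0 ≤ r) (hrβ : r ≤ 1 - β) (n : ℕ) :
    β * ∑ t ∈ Finset.range n, r ^ t + r ^ n ≤ 1 := by
  induction n with
  | zero => simp
  | succ n ih =>
    rw [Finset.sum_range_succ, pow_succ]
    nlinarith [mul_le_mul_of_nonneg_left hrβ (pow_nonneg hr n)]

/-- Recursion for the discrete convolution of a sequence with a geometric one. -/
theorem sum_range_succ_pow_sub_mul (r : ℝ) (D : ℕ → ℝ) (n : ℕ) :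
    ∑ i ∈ Finset.range (n + 1), r ^ (n + 1 - i) * D i
      = r * (∑ i ∈ Finset.range n, r ^ (n - i) * D i + D n) := by
  rw [Finset.sum_range_succ, mul_add, Finset.mul_sum, Nat.add_sub_cancel_left, pow_one]
  congr 1
  refine Finset.sum_congr rfl fun i hi => ?_
  rw [Nat.succ_sub (Finset.mem_range.mp hi).le, pow_succ]
  ring

/-- Discrete Young inequality: convolving with a geometric sequence of ratio `r ≤ 1 - β` multiplies
the `ℓ¹` norm by at most `1 / β`. -/
theorem mul_sum_convolution_add_le {r β : ℝ} (hr : 0 ≤ r) (hrβ : r ≤ 1 - β) (hβ : 0 ≤ β)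
    (D : ℕ → ℝ) (n : ℕ) (hD : ∀ i < n, 0 ≤ D i) :
    β * ∑ t ∈ Finset.range n, ∑ i ∈ Finset.range t, r ^ (t - i) * D i
        + ∑ i ∈ Finset.range n, r ^ (n - i) * D i
      ≤ ∑ i ∈ Finset.range n, D i := by
  induction n with
  | zero => simp
  | succ n ih =>
    have ih := ih fun i hi => hD i (hi.trans n.lt_succ_self)
    have hW : 0 ≤ ∑ i ∈ Finset.range n, r ^ (n - i) * D i :=
      Finset.sum_nonneg fun i hi =>
        mul_nonneg (pow_nonneg hr _) (hD i ((Finset.mem_range.mp hi).trans n.lt_succ_self))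
    rw [sum_range_succ_pow_sub_mul, Finset.sum_range_succ, Finset.sum_range_succ D]
    nlinarith [mul_le_mul_of_nonneg_left hrβ hW,
      mul_le_mul_of_nonneg_left hrβ (hD n n.lt_succ_self),
      mul_nonneg hβ (hD n n.lt_succ_self)]

/-- Telescoped form of the descent recursion. -/
theorem sum_descent_le {c a : ℝ} {E G D S : ℕ → ℝ} (n : ℕ)
    (h : ∀ t < n, E (t + 1) ≤ E t - c * D t - a * G t + a * S t) :
    E n + c * ∑ t ∈ Finset.range n, D t + a * ∑ t ∈ Finset.range n, G t
      ≤ E 0 + a * ∑ t ∈ Finset.range n, S t := by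
  induction n with
  | zero => simp
  | succ n ih =>
    have ih := ih fun t ht => h t (ht.trans n.lt_succ_self)
    simp only [Finset.sum_range_succ, mul_add]
    linarith [h n n.lt_succ_self]


/-- Deterministic core of the first part of the main theorem (Theorem 1, eq. (5)):
combining the descent recursion and the unrolled variance bound yields
`(1/(T+1)) ∑_{t=0}^T G_t ≤ 2E_0/(η(T+1)) + S_0/(β(T+1)) + 2βσ²`. -/
theorem main_rate_general
    (L σ η β : ℝ) (hL : 0 < L) (hσ : 0 ≤ σ)
    (hη0 : 0 < η) (hη1 : η < 1 / (2 * L))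
    (hβ0 : 2 * L ^ 2 * η ^ 2 / (1 - L * η) ≤ β) (hβ1 : β < 1)
    (T : ℕ) (En G D S : ℕ → ℝ)
    (hEn : ∀ t ≤ T + 1, 0 ≤ En t) (hG : ∀ t ≤ T, 0 ≤ G t)
    (hD : ∀ t ≤ T, 0 ≤ D t) (hS : ∀ t ≤ T, 0 ≤ S t)
    (hdescent : ∀ t ≤ T,
      En (t + 1) ≤ En t - (1 / (2 * η) - L / 2) * D t - (η / 2) * G t + (η / 2) * S t)
    (hvariance : ∀ t ≤ T,
      S t ≤ (1 - β) ^ (2 * t) * S 0 + 2 * β * σ ^ 2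
        + 2 * L ^ 2 * ∑ i ∈ Finset.range t, (1 - β) ^ (2 * (t - i)) * D i) :
    (1 / ((T : ℝ) + 1)) * ∑ t ∈ Finset.range (T + 1), G t
      ≤ 2 * En 0 / (η * ((T : ℝ) + 1)) + S 0 / (β * ((T : ℝ) + 1)) + 2 * β * σ ^ 2 := by
  have hLη : 0 < 1 - L * η := by
    rw [lt_div_iff₀ (by positivity)] at hη1
    nlinarith
  have hβ : 0 < β := lt_of_lt_of_le (by positivity) hβ0
  have hr : 0 ≤ (1 - β) ^ 2 := sq_nonneg _
  have hrβ : (1 - β) ^ 2 ≤ 1 - β := by nlinarith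
  have hlt {t : ℕ} (ht : t < T + 1) : t ≤ T := Nat.lt_succ_iff.mp ht
  have hcoef : L ^ 2 * η / β ≤ 1 / (2 * η) - L / 2 := by
    rw [div_le_iff₀ hLη] at hβ0
    have heq : 1 / (2 * η) - L / 2 = (1 - L * η) / (2 * η) := by field_simp
    rw [heq, div_le_div_iff₀ hβ (by positivity)]
    linarith
  have hsum := sum_descent_le (T + 1) fun t ht => hdescent t (hlt ht)
  have hgeom : ∑ t ∈ Finset.range (T + 1), ((1 - β) ^ 2) ^ t ≤ 1 / β := by
    rw [le_div_iff₀' hβ]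
    linarith [mul_sum_pow_add_pow_le_one hr hrβ (T + 1), pow_nonneg hr (T + 1)]
  have hconv : ∑ t ∈ Finset.range (T + 1), ∑ i ∈ Finset.range t, ((1 - β) ^ 2) ^ (t - i) * D i
      ≤ (∑ t ∈ Finset.range (T + 1), D t) / β := by
    rw [le_div_iff₀' hβ]
    have hnonneg : 0 ≤ ∑ i ∈ Finset.range (T + 1), ((1 - β) ^ 2) ^ (T + 1 - i) * D i :=
      Finset.sum_nonneg fun i hi =>
        mul_nonneg (pow_nonneg hr _) (hD i (hlt (Finset.mem_range.mp hi)))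
    linarith [mul_sum_convolution_add_le hr hrβ hβ.le D (T + 1) fun i hi => hD i (hlt hi)]
  have hSsum : ∑ t ∈ Finset.range (T + 1), S t
      ≤ 1 / β * S 0 + (T + 1) * (2 * β * σ ^ 2)
        + 2 * L ^ 2 * ((∑ t ∈ Finset.range (T + 1), D t) / β) := by
    refine (Finset.sum_le_sum fun t ht => hvariance t (hlt (Finset.mem_range.mp ht))).trans ?_
    simp only [pow_mul, Finset.sum_add_distrib, ← Finset.mul_sum, ← Finset.sum_mul,
      Finset.sum_const, Finset.card_range, nsmul_eq_mul]
    push_cast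
    linarith [mul_le_mul_of_nonneg_right hgeom (hS 0 T.zero_le),
      mul_le_mul_of_nonneg_left hconv (by positivity : 0 ≤ 2 * L ^ 2)]
  have hDsum : 0 ≤ ∑ t ∈ Finset.range (T + 1), D t :=
    Finset.sum_nonneg fun t ht => hD t (hlt (Finset.mem_range.mp ht))
  have hGsum : η / 2 * ∑ t ∈ Finset.range (T + 1), G t
      ≤ En 0 + η / 2 * (1 / β * S 0 + (T + 1) * (2 * β * σ ^ 2)) := by
    have hcancel := mul_le_mul_of_nonneg_right hcoef hDsum
    have hscaled := mul_le_mul_of_nonneg_left hSsum (half_pos hη0).le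
    have heq : η / 2 * (2 * L ^ 2 * ((∑ t ∈ Finset.range (T + 1), D t) / β))
        = L ^ 2 * η / β * ∑ t ∈ Finset.range (T + 1), D t := by ring
    rw [mul_add, heq] at hscaled
    linarith [hEn (T + 1) le_rfl]
  calc 1 / ((T : ℝ) + 1) * ∑ t ∈ Finset.range (T + 1), G t
      = 2 / (η * (T + 1)) * (η / 2 * ∑ t ∈ Finset.range (T + 1), G t) := by field_simp
    _ ≤ 2 / (η * (T + 1)) * (En 0 + η / 2 * (1 / β * S 0 + (T + 1) * (2 * β * σ ^ 2))) := by
      gcongr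
    _ = 2 * En 0 / (η * ((T : ℝ) + 1)) + S 0 / (β * ((T : ℝ) + 1)) + 2 * β * σ ^ 2 := by
      field_simp
      ring
end

section
/- Let L > 0, σ ≥ 0, and let T ≥ 1 be a natural number. Set η := 1/(2L(T+1)^{1/3}) and β := 1/(T+1)^{2/3}. Let (E_t)_{t=0}^{T+1}, (G_t)_{t=0}^{T}, (D_t)_{t=0}^{T}, (S_t)_{t=0}^{T} be nonnegative real numbers satisfying, for every 0 ≤ t ≤ T: E_{t+1} ≤ E_t − (1/(2η) − L/2) D_t − (η/2) G_t + (η/2) S_t, and S_t ≤ (1−β)^{2t} S_0 + 2βσ² + 2L² ∑_{i=0}^{t−1} (1−β)^{2(t−i)} D_i, and additionally S_0 ≤ 2σ²/(T+1)^{1/3}. Then (1/(T+1)) ∑_{t=0}^{T} G_t ≤ (4L E_0 + 4σ²)/(T+1)^{2/3}. -/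
/-- If `0 ≤ q ≤ 1 - β`, the geometric partial sums `∑ q ^ t` are at most `1 / β`
(stated with the remainder term). -/
theorem mul_sum_geometric_add_le_one {q β : ℝ} (hq : 0 ≤ q) (hqβ : q ≤ 1 - β) (n : ℕ) :
    β * ∑ t ∈ Finset.range n, q ^ t + q ^ n ≤ 1 := by
  induction n with
  | zero => simp
  | succ n ih =>
    rw [Finset.sum_range_succ, pow_succ]
    nlinarith [mul_le_mul_of_nonneg_left hqβ (pow_nonneg hq n)]

/-- If `0 ≤ q ≤ 1 - β`, summing the geometric convolutions of a nonnegative sequence `D` loses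
at most a factor `1 / β` (stated with the remainder term). -/
theorem mul_sum_geometric_convolution_add_le {q β : ℝ} (hq : 0 ≤ q) (hqβ : q ≤ 1 - β)
    (hβ : 0 ≤ β) {D : ℕ → ℝ} (n : ℕ) (hD : ∀ i < n, 0 ≤ D i) :
    β * ∑ t ∈ Finset.range n, ∑ i ∈ Finset.range t, q ^ (t - i) * D i
      + ∑ i ∈ Finset.range n, q ^ (n - i) * D i ≤ ∑ i ∈ Finset.range n, D i := by
  induction n with
  | zero => simp
  | succ n ih =>
    have ih := ih fun i hi => hD i (by omega)
    have hDn := hD n (by omega)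
    have hA : 0 ≤ ∑ i ∈ Finset.range n, q ^ (n - i) * D i :=
      Finset.sum_nonneg fun i hi =>
        mul_nonneg (pow_nonneg hq _) (hD i (by have := Finset.mem_range.1 hi; omega))
    have hrec : ∑ i ∈ Finset.range n, q ^ (n + 1 - i) * D i
        = q * ∑ i ∈ Finset.range n, q ^ (n - i) * D i := by
      rw [Finset.mul_sum]
      refine Finset.sum_congr rfl fun i hi => ?_
      rw [Nat.succ_sub (Finset.mem_range.1 hi).le, pow_succ]
      ring
    rw [Finset.sum_range_succ, Finset.sum_range_succ _ n, Finset.sum_range_succ _ n, hrec,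
      Nat.add_sub_cancel_left, pow_one]
    nlinarith [mul_le_mul_of_nonneg_right hqβ hA,
      mul_le_mul_of_nonneg_right (hqβ.trans (sub_le_self 1 hβ)) hDn]

/-- Deterministic core of the second part of the main theorem (Theorem 1, eq. (6)):
with `η = 1/(2L(T+1)^{1/3})`, `β = (T+1)^{-2/3}` and `S_0 ≤ 2σ²/(T+1)^{1/3}`, the
averaged quantity `(1/(T+1)) ∑_{t=0}^T G_t` is at most `(4L E_0 + 4σ²)/(T+1)^{2/3}`. -/
theorem main_rate_specific
    (L σ : ℝ) (hL : 0 < L) (hσ : 0 ≤ σ)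
    (T : ℕ) (hT : 1 ≤ T)
    (η β : ℝ)
    (hη : η = 1 / (2 * L * ((T : ℝ) + 1) ^ ((1 : ℝ) / 3)))
    (hβ : β = 1 / ((T : ℝ) + 1) ^ ((2 : ℝ) / 3))
    (En G D S : ℕ → ℝ)
    (hEn : ∀ t ≤ T + 1, 0 ≤ En t) (hG : ∀ t ≤ T, 0 ≤ G t)
    (hD : ∀ t ≤ T, 0 ≤ D t) (hS : ∀ t ≤ T, 0 ≤ S t)
    (hdescent : ∀ t ≤ T,
      En (t + 1) ≤ En t - (1 / (2 * η) - L / 2) * D t - (η / 2) * G t + (η / 2) * S t)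
    (hvariance : ∀ t ≤ T,
      S t ≤ (1 - β) ^ (2 * t) * S 0 + 2 * β * σ ^ 2
        + 2 * L ^ 2 * ∑ i ∈ Finset.range t, (1 - β) ^ (2 * (t - i)) * D i)
    (hS0 : S 0 ≤ 2 * σ ^ 2 / ((T : ℝ) + 1) ^ ((1 : ℝ) / 3)) :
    (1 / ((T : ℝ) + 1)) * ∑ t ∈ Finset.range (T + 1), G t
      ≤ (4 * L * En 0 + 4 * σ ^ 2) / ((T : ℝ) + 1) ^ ((2 : ℝ) / 3) := by
  obtain ⟨c, hc, hc1, hc2, hc3⟩ : ∃ c : ℝ, c = ((T : ℝ) + 1) ^ ((1 : ℝ) / 3) ∧ 1 ≤ c ∧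
      ((T : ℝ) + 1) ^ ((2 : ℝ) / 3) = c ^ 2 ∧ (T : ℝ) + 1 = c ^ 3 := by
    have hN : (0 : ℝ) ≤ (T : ℝ) + 1 := by positivity
    refine ⟨_, rfl, Real.one_le_rpow (by simp) (by norm_num), ?_, ?_⟩
    · rw [← Real.rpow_mul_natCast hN]
      norm_num
    · rw [← Real.rpow_mul_natCast hN]
      norm_num
  rw [← hc] at hη hS0
  rw [hc2] at hβ ⊢
  have hc0 : 0 < c := by linarith
  have hβ0 : 0 ≤ β := by rw [hβ]; positivity
  have hβ1 : β ≤ 1 := by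
    rw [hβ, div_le_one (by positivity)]
    exact one_le_pow₀ hc1
  have hβc : β * c ^ 2 = 1 := by rw [hβ]; field_simp
  have hq : 0 ≤ (1 - β) ^ 2 := sq_nonneg _
  have hqβ : (1 - β) ^ 2 ≤ 1 - β := by nlinarith
  have hgeom : ∑ t ∈ Finset.range (T + 1), ((1 - β) ^ 2) ^ t ≤ c ^ 2 := by
    have h := mul_sum_geometric_add_le_one hq hqβ (T + 1)
    have hpow := pow_nonneg hq (T + 1)
    calc _ = c ^ 2 * (β * ∑ t ∈ Finset.range (T + 1), ((1 - β) ^ 2) ^ t) := by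
          rw [← mul_assoc, mul_comm (c ^ 2), hβc, one_mul]
      _ ≤ c ^ 2 * 1 := by gcongr; linarith
      _ = c ^ 2 := mul_one _
  have hconv : ∑ t ∈ Finset.range (T + 1), ∑ i ∈ Finset.range t, ((1 - β) ^ 2) ^ (t - i) * D i
      ≤ c ^ 2 * ∑ i ∈ Finset.range (T + 1), D i := by
    have h := mul_sum_geometric_convolution_add_le hq hqβ hβ0 (T + 1)
      fun i hi => hD i (Nat.lt_succ_iff.1 hi)
    have hrem : 0 ≤ ∑ i ∈ Finset.range (T + 1), ((1 - β) ^ 2) ^ (T + 1 - i) * D i :=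
      Finset.sum_nonneg fun i hi =>
        mul_nonneg (pow_nonneg hq _) (hD i (Nat.lt_succ_iff.1 (Finset.mem_range.1 hi)))
    calc _ = c ^ 2 * (β * ∑ t ∈ Finset.range (T + 1),
            ∑ i ∈ Finset.range t, ((1 - β) ^ 2) ^ (t - i) * D i) := by
          rw [← mul_assoc, mul_comm (c ^ 2), hβc, one_mul]
      _ ≤ _ := by gcongr; linarith
  have hSsum : ∑ t ∈ Finset.range (T + 1), S t
      ≤ 4 * σ ^ 2 * c + 2 * L ^ 2 * c ^ 2 * ∑ i ∈ Finset.range (T + 1), D i := by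
    have h := Finset.sum_le_sum fun t ht =>
      hvariance t (Nat.lt_succ_iff.1 (Finset.mem_range.1 ht))
    simp only [pow_mul, Finset.sum_add_distrib, ← Finset.sum_mul, ← Finset.mul_sum,
      Finset.sum_const, Finset.card_range, nsmul_eq_mul] at h
    push_cast at h
    rw [hc3] at h
    have h1 : (∑ t ∈ Finset.range (T + 1), ((1 - β) ^ 2) ^ t) * S 0 ≤ 2 * σ ^ 2 * c :=
      calc _ ≤ c ^ 2 * (2 * σ ^ 2 / c) := mul_le_mul hgeom hS0 (hS 0 (by omega)) (by positivity)
        _ = 2 * σ ^ 2 * c := by field_simp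
    have h2 : c ^ 3 * (2 * β * σ ^ 2) = 2 * σ ^ 2 * c := by linear_combination 2 * c * σ ^ 2 * hβc
    have h3 := mul_le_mul_of_nonneg_left hconv (by positivity : 0 ≤ 2 * L ^ 2)
    linarith
  have hGt : ∀ t ∈ Finset.range (T + 1),
      G t ≤ 4 * L * c * (En t - En (t + 1)) - 2 * L ^ 2 * c ^ 2 * D t + S t := by
    intro t ht
    have ht := Nat.lt_succ_iff.1 (Finset.mem_range.1 ht)
    have h := mul_le_mul_of_nonneg_left (hdescent t ht) (by positivity : 0 ≤ 4 * L * c)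
    have hη1 : 1 / (2 * η) = L * c := by rw [hη]; field_simp
    have hη2 : 4 * L * c * (η / 2) = 1 := by rw [hη]; field_simp; norm_num
    rw [hη1] at h
    have h' : 4 * L * c * En (t + 1)
        ≤ 4 * L * c * En t - 4 * L * c * (L * c - L / 2) * D t - G t + S t := by
      linear_combination h + (S t - G t) * hη2
    have hcD : 0 ≤ 2 * L ^ 2 * (c * (c - 1)) * D t :=
      mul_nonneg (mul_nonneg (by positivity) (mul_nonneg hc0.le (by linarith))) (hD t ht)
    linarith
  have hGsum : ∑ t ∈ Finset.range (T + 1), G t ≤ (4 * L * En 0 + 4 * σ ^ 2) * c := by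
    have h := Finset.sum_le_sum hGt
    rw [Finset.sum_add_distrib, Finset.sum_sub_distrib, ← Finset.mul_sum, ← Finset.mul_sum,
      Finset.sum_range_sub'] at h
    have hE := mul_nonneg (by positivity : 0 ≤ 4 * L * c) (hEn (T + 1) le_rfl)
    linarith
  rw [hc3]
  calc _ ≤ 1 / c ^ 3 * ((4 * L * En 0 + 4 * σ ^ 2) * c) := by gcongr
    _ = _ := by field_simp
end
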